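/- Fix z > 0 and α ∈ ℝ. Set t := (1 + z²)^{−1/2}, β := √(1 + z²) + ln( z / (1 + √(1 + z²)) ), and define C_1 := t/8 − α² t/2 − α t²/2 − 5t³/24, C_2 := t²/16 − α² t²/4 − 13α t³/24 + α³ t³/6 − 3t⁴/8 + α² t⁴/2 + 5α t⁵/8 + 5t⁶/16, C_3 := 25t³/384 − 13α² t³/48 + α⁴ t³/24 − 7α t⁴/8 + α³ t⁴/2 − 531t⁵/640 + 7α² t⁵/4 − α⁴ t⁵/8 + 11α t⁶/4 − 2α³ t⁶/3 + 221t⁷/128 − 25α² t⁷/16 − 15α t⁸/8 − 1105t⁹/1152. Then, as ν → ∞ along the positive reals, √(2πν) · e^{−νβ} · t^{−1/2} · ((1+t)/(1−t))^{α/2} · I_{ν+α}(νz) = exp( C_1/ν + C_2/ν² + C_3/ν³ ) + O(ν^{−4}) (shifted Debye expansion of the modified Bessel function of the first kind). -/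

import Mathlib

open scoped Real
open Filter

/-- Modified Bessel function of the first kind of real order `μ` (for `x > 0`), defined
by its power series `I_μ(x) = ∑_k (x/2)^{μ+2k}/(k! Γ(μ+k+1))` with real powers. -/
noncomputable def besselI (μ : ℝ) (x : ℝ) : ℝ :=
  ∑' k : ℕ, (x / 2) ^ (μ + 2 * (k : ℝ)) / ((k.factorial : ℝ) * Real.Gamma (μ + k + 1))

/-- A function on the reals that tends to `0` along every sequence `ν + n` and whose unit increments
are `O(ν⁻⁵)` is itself `O(ν⁻⁴)`. -/
theorem abs_le_of_abs_add_one_sub_le {f : ℝ → ℝ} {M N : ℝ} (hN : 1 ≤ N)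
    (hstep : ∀ ν, N ≤ ν → |f (ν + 1) - f ν| ≤ M / ν ^ 5)
    (hlim : ∀ ν, N ≤ ν → Tendsto (fun n : ℕ => f (ν + n)) atTop (nhds 0))
    {ν : ℝ} (hν : N ≤ ν) : |f ν| ≤ 8 * M / ν ^ 4 := by
  have hM : 0 ≤ M := by
    have h := (abs_nonneg _).trans (hstep N le_rfl)
    have : 0 < N ^ 5 := by positivity
    by_contra hneg
    exact absurd h (not_le.mpr (div_neg_of_neg_of_pos (not_le.mp hneg) this))
  have htel : ∀ y : ℝ, 1 ≤ y → M / y ^ 5 ≤ 8 * M / y ^ 4 - 8 * M / (y + 1) ^ 4 := by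
    intro y hy
    have hkey : 1 / y ^ 5 ≤ 8 / y ^ 4 - 8 / (y + 1) ^ 4 := by
      have hy0 : 0 < y := by linarith
      rw [div_sub_div _ _ (by positivity) (by positivity), div_le_div_iff₀ (by positivity)
        (by positivity)]
      have hpoly : 0 ≤ 8 * y * ((y + 1) ^ 4 - y ^ 4) - (y + 1) ^ 4 := by
        obtain ⟨w, rfl⟩ : ∃ w, y = 1 + w := ⟨y - 1, by ring⟩
        have hw : 0 ≤ w := by linarith
        ring_nf
        positivity
      have := mul_nonneg (pow_nonneg hy0.le 4) hpoly
      nlinarith [this]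
    calc M / y ^ 5 = M * (1 / y ^ 5) := by ring
      _ ≤ M * (8 / y ^ 4 - 8 / (y + 1) ^ 4) := by gcongr
      _ = _ := by ring
  have hsum : ∀ n : ℕ, |f (ν + n) - f ν| ≤ 8 * M / ν ^ 4 - 8 * M / (ν + n) ^ 4 := by
    intro n
    induction n with
    | zero => simp
    | succ n ih =>
      have hn : (0 : ℝ) ≤ n := n.cast_nonneg
      have h1 := hstep (ν + n) (by linarith)
      have h2 := htel (ν + n) (by linarith)
      have h3 := abs_add_le (f (ν + n + 1) - f (ν + n)) (f (ν + n) - f ν)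
      rw [sub_add_sub_cancel] at h3
      push_cast
      rw [← add_assoc]
      linarith
  have hle : ∀ n : ℕ, |f (ν + n) - f ν| ≤ 8 * M / ν ^ 4 := by
    intro n
    have : 0 ≤ 8 * M / (ν + n) ^ 4 := by positivity
    linarith [hsum n]
  have hlimAbs : Tendsto (fun n : ℕ => |f (ν + n) - f ν|) atTop (nhds |0 - f ν|) :=
    ((hlim ν hν).sub_const _).abs
  simpa using le_of_tendsto' hlimAbs hle

theorem isBigO_log_one_add_mul_sub (a : ℝ) (n : ℕ) :
    (fun x : ℝ => Real.log (1 + a * x) + ∑ i ∈ Finset.range n, (-(a * x)) ^ (i + 1) / (i + 1))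
      =O[nhds 0] fun x => x ^ (n + 1) := by
  have hc : Tendsto (fun x : ℝ => |-(a * x)|) (nhds 0) (nhds 0) := by
    have : Continuous fun x : ℝ => |-(a * x)| := by fun_prop
    simpa using this.tendsto 0
  refine Asymptotics.IsBigO.of_bound (2 * |a| ^ (n + 1)) ?_
  filter_upwards [hc.eventually (gt_mem_nhds (show (0 : ℝ) < 1 / 2 by norm_num))] with x hx
  have h := Real.abs_log_sub_add_sum_range_le (x := -(a * x)) (by linarith) n
  rw [sub_neg_eq_add, add_comm] at h
  rw [Real.norm_eq_abs, Real.norm_eq_abs]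
  refine h.trans ?_
  rw [div_le_iff₀ (by linarith), abs_neg, abs_mul, mul_pow, abs_pow]
  rw [abs_neg, abs_mul] at hx
  have : 0 ≤ |a| ^ (n + 1) * |x| ^ (n + 1) := by positivity
  nlinarith

theorem tendsto_log_Gamma_add_nat (s : ℝ) (hs : 0 < s) :
    Tendsto (fun n : ℕ => Real.log (Real.Gamma (s + n + 1)) - s * Real.log n
      - Real.log n.factorial) atTop (nhds 0) := by
  have hΓ := Real.Gamma_pos_of_pos hs
  have h1 : Tendsto (fun n => Real.log (Real.Gamma s) - Real.log (Real.GammaSeq s n)) atTop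
      (nhds 0) := by
    have := ((Real.GammaSeq_tendsto_Gamma s).log hΓ.ne').const_sub (Real.log (Real.Gamma s))
    simpa using this
  refine h1.congr' ?_
  filter_upwards [eventually_gt_atTop 0] with n hn
  have hprod : ∀ n : ℕ, Real.Gamma (s + n + 1) =
      Real.Gamma s * ∏ j ∈ Finset.range (n + 1), (s + j) := by
    intro n
    induction n with
    | zero => simp [Real.Gamma_add_one hs.ne', mul_comm]
    | succ n ih =>
      rw [Finset.prod_range_succ, ← mul_assoc, ← ih, Real.Gamma_add_one (by positivity)]
      push_cast
      ring_nf
  have hP : 0 < ∏ j ∈ Finset.range (n + 1), (s + (j : ℝ)) :=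
    Finset.prod_pos fun j _ => by positivity
  have hnpos : (0 : ℝ) < n := by exact_mod_cast hn
  rw [hprod, Real.GammaSeq, Real.log_div (by positivity) hP.ne',
    Real.log_mul (by positivity) (by positivity), Real.log_rpow hnpos,
    Real.log_mul hΓ.ne' hP.ne']
  ring

theorem tendsto_log_factorial_sub :
    Tendsto (fun n : ℕ => Real.log n.factorial - ((n + 1 / 2) * Real.log n - n
      + Real.log (2 * π) / 2)) atTop (nhds 0) := by
  have hπ := Real.pi_pos
  have h := (Stirling.tendsto_stirlingSeq_sqrt_pi.log (by positivity)).sub_const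
    (Real.log √π)
  rw [sub_self] at h
  refine h.congr' ?_
  filter_upwards [eventually_gt_atTop 0] with n hn
  have hnpos : (0 : ℝ) < n := by exact_mod_cast hn
  rw [Stirling.log_stirlingSeq_formula, Real.log_sqrt hπ.le, Real.log_mul (by norm_num) hπ.ne',
    Real.log_mul (by norm_num) hnpos.ne', Real.log_div hnpos.ne' (Real.exp_pos 1).ne', Real.log_exp]
  ring

theorem tendsto_mul_log_add_sub_log (ν c : ℝ) :
    Tendsto (fun n : ℕ => (n + c) * (Real.log (ν + n) - Real.log n)) atTop (nhds ν) := by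
  have h1 := (Real.tendsto_mul_log_one_add_div_atTop ν).comp tendsto_natCast_atTop_atTop
  have h0 : Tendsto (fun n : ℕ => 1 + c / (n : ℝ)) atTop (nhds (1 + 0)) :=
    (tendsto_const_div_atTop_nhds_zero_nat c).const_add 1
  have h2 := h1.mul h0
  rw [add_zero, mul_one] at h2
  refine h2.congr' ?_
  filter_upwards [eventually_gt_atTop 0, tendsto_natCast_atTop_atTop.eventually_gt_atTop (-ν)]
    with n hn hνn
  have hnpos : (0 : ℝ) < n := by exact_mod_cast hn
  rw [← Real.log_div (by linarith) hnpos.ne', add_div, div_self hnpos.ne', add_comm (ν / _)]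
  simp only [Function.comp]
  field_simp

/-- The polynomial multiplying `ν⁻¹` in the exponent of the shifted Debye expansion. -/
noncomputable def debyeC₁ (α t : ℝ) : ℝ :=
  t / 8 - α ^ 2 * t / 2 - α * t ^ 2 / 2 - 5 * t ^ 3 / 24

/-- The polynomial multiplying `ν⁻²` in the exponent of the shifted Debye expansion. -/
noncomputable def debyeC₂ (α t : ℝ) : ℝ :=
  t ^ 2 / 16 - α ^ 2 * t ^ 2 / 4 - 13 * α * t ^ 3 / 24 + α ^ 3 * t ^ 3 / 6 -
    3 * t ^ 4 / 8 + α ^ 2 * t ^ 4 / 2 + 5 * α * t ^ 5 / 8 + 5 * t ^ 6 / 16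

/-- The polynomial multiplying `ν⁻³` in the exponent of the shifted Debye expansion. -/
noncomputable def debyeC₃ (α t : ℝ) : ℝ :=
  25 * t ^ 3 / 384 - 13 * α ^ 2 * t ^ 3 / 48 + α ^ 4 * t ^ 3 / 24 -
    7 * α * t ^ 4 / 8 + α ^ 3 * t ^ 4 / 2 - 531 * t ^ 5 / 640 + 7 * α ^ 2 * t ^ 5 / 4 -
    α ^ 4 * t ^ 5 / 8 + 11 * α * t ^ 6 / 4 - 2 * α ^ 3 * t ^ 6 / 3 + 221 * t ^ 7 / 128 -
    25 * α ^ 2 * t ^ 7 / 16 - 15 * α * t ^ 8 / 8 - 1105 * t ^ 9 / 1152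

/-- The exponent `C₁/ν + C₂/ν² + C₃/ν³` of the shifted Debye expansion. -/
noncomputable def debyeExponent (α ν t : ℝ) : ℝ :=
  debyeC₁ α t / ν + debyeC₂ α t / ν ^ 2 + debyeC₃ α t / ν ^ 3

/-- The remainder of `log Γ(ν + α + 1)` after its shifted Stirling expansion through `ν⁻³`. -/
noncomputable def stirlingRemainder (α ν : ℝ) : ℝ :=
  Real.log (Real.Gamma (ν + α + 1)) - ((ν + α + 1 / 2) * Real.log ν - ν + Real.log (2 * π) / 2
    - debyeExponent α ν 1)

theorem tendsto_debyeExponent_atTop (α t : ℝ) :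
    Tendsto (fun ν => debyeExponent α ν t) atTop (nhds 0) := by
  have h : ∀ (c : ℝ) (k : ℕ), k ≠ 0 → Tendsto (fun ν : ℝ => c / ν ^ k) atTop (nhds 0) :=
    fun c k hk => tendsto_const_nhds.div_atTop (tendsto_pow_atTop hk)
  have := ((h (debyeC₁ α t) 1 one_ne_zero).add (h (debyeC₂ α t) 2 two_ne_zero)).add
    (h (debyeC₃ α t) 3 three_ne_zero)
  simpa [debyeExponent] using this

theorem tendsto_stirlingRemainder_add_nat {α ν : ℝ} (hα : 0 < ν + α) :
    Tendsto (fun n : ℕ => stirlingRemainder α (ν + n)) atTop (nhds 0) := by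
  have h1 := tendsto_log_Gamma_add_nat (ν + α) hα
  have h2 := tendsto_log_factorial_sub
  have h3 := tendsto_mul_log_add_sub_log ν (ν + α + 1 / 2)
  have h4 := (tendsto_debyeExponent_atTop α 1).comp
    (tendsto_atTop_add_const_left atTop ν tendsto_natCast_atTop_atTop)
  have h := ((h1.add h2).add (h3.const_sub ν)).add h4
  simp only [sub_self, add_zero] at h
  refine h.congr fun n => ?_
  simp only [stirlingRemainder, Function.comp]
  rw [show ν + (n : ℝ) + α + 1 = ν + α + n + 1 by ring]
  ring

theorem stirlingRemainder_add_one_sub {α ν : ℝ} (hν : 0 < ν) (hα : 0 < ν + α + 1) :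
    stirlingRemainder α (ν + 1) - stirlingRemainder α ν =
      (Real.log (1 + (α + 1) * ν⁻¹) +
        ∑ i ∈ Finset.range 4, (-((α + 1) * ν⁻¹)) ^ (i + 1) / (i + 1)) -
      (1 + (α + 3 / 2) * ν⁻¹) * (ν * (Real.log (1 + 1 * ν⁻¹) +
        ∑ i ∈ Finset.range 5, (-(1 * ν⁻¹)) ^ (i + 1) / (i + 1))) +
      (debyeC₁ α 1 / (1 + ν⁻¹) - debyeC₂ α 1 * (4 + 3 * ν⁻¹) / (1 + ν⁻¹) ^ 2 +
        debyeC₃ α 1 * (6 + 8 * ν⁻¹ + 3 * (ν⁻¹) ^ 2) / (1 + ν⁻¹) ^ 3 - (α + 3 / 2) / 5) *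
          (ν⁻¹) ^ 5 := by
  have e1 : Real.log (1 + (α + 1) * ν⁻¹) = Real.log (ν + α + 1) - Real.log ν := by
    rw [← Real.log_div hα.ne' hν.ne']
    congr 1
    field_simp
    ring
  have e2 : Real.log (1 + 1 * ν⁻¹) = Real.log (ν + 1) - Real.log ν := by
    rw [← Real.log_div (by positivity) hν.ne']
    congr 1
    field_simp
  have e3 : Real.log (Real.Gamma (ν + 1 + α + 1)) =
      Real.log (ν + α + 1) + Real.log (Real.Gamma (ν + α + 1)) := by
    rw [show ν + 1 + α + 1 = ν + α + 1 + 1 by ring, Real.Gamma_add_one hα.ne',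
      Real.log_mul hα.ne' (Real.Gamma_pos_of_pos hα).ne']
  rw [e1, e2]
  simp only [stirlingRemainder, debyeExponent, debyeC₁, debyeC₂, debyeC₃, e3,
    Finset.sum_range_succ, Finset.sum_range_zero]
  generalize Real.log (Real.Gamma (ν + α + 1)) = a
  generalize Real.log (ν + α + 1) = b
  generalize Real.log (ν + 1) = c
  generalize Real.log ν = d
  push_cast
  field_simp
  ring

theorem isBigO_stirlingRemainder_add_one_sub (α : ℝ) :
    (fun ν => stirlingRemainder α (ν + 1) - stirlingRemainder α ν) =O[atTop]
      fun ν : ℝ => (ν⁻¹) ^ 5 := by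
  have hinv : Tendsto (fun ν : ℝ => ν⁻¹) atTop (nhds 0) := tendsto_inv_atTop_zero
  have hA := (isBigO_log_one_add_mul_sub (α + 1) 4).comp_tendsto hinv
  have hB := (isBigO_log_one_add_mul_sub 1 5).comp_tendsto hinv
  have hlim : ∀ {f : ℝ → ℝ}, ContinuousAt f 0 →
      (fun ν : ℝ => f ν⁻¹) =O[atTop] fun _ => (1 : ℝ) :=
    fun hf => (hf.tendsto.comp hinv).isBigO_one ℝ
  have hBscaled : (fun ν : ℝ => ν * (Real.log (1 + 1 * ν⁻¹) +
      ∑ i ∈ Finset.range 5, (-(1 * ν⁻¹)) ^ (i + 1) / (i + 1))) =O[atTop]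
        fun ν : ℝ => (ν⁻¹) ^ 5 := by
    refine ((Asymptotics.isBigO_refl (fun ν : ℝ => ν) atTop).mul hB).congr' .rfl ?_
    filter_upwards [eventually_gt_atTop 0] with ν hν
    show ν * (ν⁻¹) ^ 6 = (ν⁻¹) ^ 5
    rw [pow_succ' _ 5, mul_inv_cancel_left₀ hν.ne']
  have hBmul := (hlim (f := fun x => 1 + (α + 3 / 2) * x) (by fun_prop)).mul hBscaled
  have hC := (hlim (f := fun x => debyeC₁ α 1 / (1 + x) -
      debyeC₂ α 1 * (4 + 3 * x) / (1 + x) ^ 2 +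
      debyeC₃ α 1 * (6 + 8 * x + 3 * x ^ 2) / (1 + x) ^ 3 - (α + 3 / 2) / 5)
      (by fun_prop (disch := norm_num))).mul
    (Asymptotics.isBigO_refl (fun ν : ℝ => (ν⁻¹) ^ 5) atTop)
  simp only [one_mul] at hBmul hC
  refine ((hA.sub hBmul).add hC).congr' ?_ .rfl
  filter_upwards [eventually_gt_atTop 0, eventually_gt_atTop (-α - 1)] with ν hν hα
  rw [stirlingRemainder_add_one_sub hν (by linarith)]
  simp only [Function.comp, one_mul]

/-- The Stirling expansion of `Γ(ν + α + 1)` through `ν⁻³`, with the coefficients written as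
`-C₁(1), -C₂(1), -C₃(1)`. -/
theorem isBigO_stirlingRemainder (α : ℝ) :
    stirlingRemainder α =O[atTop] fun ν : ℝ => 1 / ν ^ 4 := by
  obtain ⟨M, hM⟩ := (isBigO_stirlingRemainder_add_one_sub α).bound
  obtain ⟨N, hN⟩ := eventually_atTop.mp hM
  refine Asymptotics.IsBigO.of_bound (8 * M) ?_
  filter_upwards [eventually_ge_atTop (max N (max 1 (1 - α)))] with ν hν
  have hpos : 0 < ν := by linarith [le_max_left 1 (1 - α), le_max_right N (max 1 (1 - α))]
  have h := abs_le_of_abs_add_one_sub_le (f := stirlingRemainder α) (M := M)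
    (N := max N (max 1 (1 - α))) ((le_max_left _ _).trans (le_max_right _ _)) ?_ ?_ hν
  · rw [Real.norm_eq_abs, Real.norm_of_nonneg (by positivity)]
    rwa [mul_one_div]
  · intro y hy
    have hy0 : 0 < y := by
      linarith [le_max_left 1 (1 - α), le_max_right N (max 1 (1 - α))]
    have := hN y ((le_max_left _ _).trans hy)
    rwa [Real.norm_eq_abs, Real.norm_of_nonneg (by positivity), inv_pow, ← div_eq_mul_inv] at this
  · intro y hy
    have h2 := le_max_right 1 (1 - α)
    have h3 := le_max_right N (max 1 (1 - α))
    exact tendsto_stirlingRemainder_add_nat (by linarith)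

/-- The entire function `∑ y^k / (k! Γ(μ + k + 1))`, so that `I_μ(x) = (x/2)^μ` times its value at
`x²/4`. -/
noncomputable def besselSeries (μ y : ℝ) : ℝ :=
  ∑' k : ℕ, y ^ k / ((k.factorial : ℝ) * Real.Gamma (μ + k + 1))

theorem Gamma_add_one_le_Gamma_add_nat {μ : ℝ} (hμ : 0 ≤ μ) (k : ℕ) :
    Real.Gamma (μ + 1) ≤ Real.Gamma (μ + k + 1) := by
  induction k with
  | zero => simp
  | succ k ih =>
    have hpos : 0 < Real.Gamma (μ + k + 1) := Real.Gamma_pos_of_pos (by positivity)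
    push_cast
    rw [← add_assoc, Real.Gamma_add_one (s := μ + k + 1) (by positivity)]
    have hk : (0 : ℝ) ≤ k := k.cast_nonneg
    nlinarith

theorem norm_besselSeries_term_le {μ : ℝ} (hμ : 0 ≤ μ) (y : ℝ) (k : ℕ) :
    ‖y ^ k / ((k.factorial : ℝ) * Real.Gamma (μ + k + 1))‖ ≤
      |y| ^ k / k.factorial / Real.Gamma (μ + 1) := by
  have h0 : 0 < Real.Gamma (μ + 1) := Real.Gamma_pos_of_pos (by positivity)
  have hle := Gamma_add_one_le_Gamma_add_nat hμ k
  rw [norm_div, norm_pow, Real.norm_eq_abs, Real.norm_of_nonneg (by positivity), div_div]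
  gcongr

theorem summable_besselSeries {μ : ℝ} (hμ : 0 ≤ μ) (y : ℝ) :
    Summable fun k : ℕ => y ^ k / ((k.factorial : ℝ) * Real.Gamma (μ + k + 1)) :=
  .of_norm_bounded ((Real.summable_pow_div_factorial |y|).div_const _)
    (norm_besselSeries_term_le hμ y)

theorem besselSeries_pos {μ y : ℝ} (hμ : 0 ≤ μ) (hy : 0 ≤ y) : 0 < besselSeries μ y := by
  have hΓ : ∀ k : ℕ, 0 < Real.Gamma (μ + k + 1) := fun k => Real.Gamma_pos_of_pos (by positivity)
  refine (summable_besselSeries hμ y).tsum_pos (fun k => ?_) 0 ?_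
  · have := hΓ k
    positivity
  · have := hΓ 0
    simp only [pow_zero]
    positivity

theorem besselSeries_zero (μ : ℝ) : besselSeries μ 0 = (Real.Gamma (μ + 1))⁻¹ := by
  rw [besselSeries, tsum_eq_single 0 fun k hk => by simp [hk]]
  simp

theorem hasDerivAt_besselSeries {μ : ℝ} (hμ : 0 ≤ μ) (y : ℝ) :
    HasDerivAt (besselSeries μ) (besselSeries (μ + 1) y) y := by
  have hterm : ∀ (k : ℕ) (x : ℝ),
      ((k + 1 : ℕ) : ℝ) * x ^ k / (((k + 1).factorial : ℝ) * Real.Gamma (μ + (k + 1 : ℕ) + 1)) =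
        x ^ k / ((k.factorial : ℝ) * Real.Gamma (μ + 1 + k + 1)) := by
    intro k x
    rw [Nat.factorial_succ, show μ + ((k + 1 : ℕ) : ℝ) + 1 = μ + 1 + k + 1 by push_cast; ring]
    push_cast
    rw [mul_assoc, mul_div_mul_left _ _ (by positivity)]
  let r := |y| + 1
  let u : ℕ → ℝ := fun k =>
    (k : ℝ) * r ^ (k - 1) / ((k.factorial : ℝ) * Real.Gamma (μ + k + 1))
  have hu : Summable u := by
    rw [← summable_nat_add_iff 1]
    simpa only [u, Nat.add_sub_cancel, hterm] using
      summable_besselSeries (by linarith : 0 ≤ μ + 1) r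
  have hderiv := hasDerivAt_tsum_of_isPreconnected (u := u) (t := Metric.ball 0 r)
    (g := fun (k : ℕ) x => x ^ k / ((k.factorial : ℝ) * Real.Gamma (μ + k + 1)))
    (g' := fun (k : ℕ) x =>
      (k : ℝ) * x ^ (k - 1) / ((k.factorial : ℝ) * Real.Gamma (μ + k + 1)))
    hu Metric.isOpen_ball (convex_ball 0 r).isPreconnected
    (fun k x _ => (hasDerivAt_pow k x).div_const _) ?_ (y₀ := 0) (y := y)
    (by simp [r]; positivity) (summable_besselSeries hμ 0) (by simp [r])
  · refine hderiv.congr_deriv ?_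
    have hs : Summable fun k : ℕ =>
        (k : ℝ) * y ^ (k - 1) / ((k.factorial : ℝ) * Real.Gamma (μ + k + 1)) := by
      rw [← summable_nat_add_iff 1]
      simpa only [Nat.add_sub_cancel, hterm] using
        summable_besselSeries (by linarith : 0 ≤ μ + 1) y
    rw [hs.tsum_eq_zero_add, besselSeries]
    simp only [Nat.add_sub_cancel, hterm]
    simp
  · intro k x hx
    have hΓ : 0 < Real.Gamma (μ + k + 1) := Real.Gamma_pos_of_pos (by positivity)
    have hxr : |x| ≤ r := by
      have := Metric.mem_ball.mp hx
      rw [dist_zero_right, Real.norm_eq_abs] at this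
      exact this.le
    simp only [u]
    rw [norm_div, norm_mul, norm_pow, Real.norm_natCast, Real.norm_eq_abs,
      Real.norm_of_nonneg (by positivity : 0 ≤ (k.factorial : ℝ) * Real.Gamma (μ + k + 1))]
    gcongr

theorem besselSeries_recurrence {μ : ℝ} (hμ : 0 ≤ μ) (y : ℝ) :
    y * besselSeries (μ + 2) y + (μ + 1) * besselSeries (μ + 1) y = besselSeries μ y := by
  have h0 := summable_besselSeries hμ y
  have h1 := summable_besselSeries (by linarith : 0 ≤ μ + 1) y
  have h2 := summable_besselSeries (by linarith : 0 ≤ μ + 2) y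
  have hΓ : ∀ s : ℝ, 0 ≤ s → 0 < Real.Gamma (s + 1) := fun s hs =>
    Real.Gamma_pos_of_pos (by positivity)
  rw [besselSeries, besselSeries, besselSeries, h0.tsum_eq_zero_add, h1.tsum_eq_zero_add, mul_add,
    ← add_assoc, add_comm (y * _), add_assoc, ← tsum_mul_left, ← tsum_mul_left,
    ← (h2.mul_left y).tsum_add (((summable_nat_add_iff 1).mpr h1).mul_left (μ + 1))]
  congr 1
  · have := hΓ μ hμ
    simp only [pow_zero, Nat.factorial_zero, Nat.cast_zero, Nat.cast_one, add_zero]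
    rw [Real.Gamma_add_one (s := μ + 1) (by positivity)]
    field_simp
  · refine tsum_congr fun k => ?_
    have hk : (0 : ℝ) ≤ k := k.cast_nonneg
    have e1 : Real.Gamma (μ + 2 + k + 1) = (μ + k + 2) * Real.Gamma (μ + k + 1 + 1) := by
      rw [show μ + 2 + k + 1 = μ + k + 1 + 1 + 1 by ring, Real.Gamma_add_one (by positivity)]
      ring
    have e2 : Real.Gamma (μ + 1 + ((k + 1 : ℕ) : ℝ) + 1) =
        (μ + k + 2) * Real.Gamma (μ + k + 1 + 1) := by
      rw [← e1]
      push_cast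
      ring_nf
    have e3 : Real.Gamma (μ + ((k + 1 : ℕ) : ℝ) + 1) = Real.Gamma (μ + k + 1 + 1) := by
      push_cast
      ring_nf
    have := hΓ (μ + k + 1) (by positivity)
    rw [e1, e2, e3, Nat.factorial_succ, pow_succ]
    push_cast
    field_simp
    ring

theorem besselI_eq_rpow_mul_besselSeries (μ : ℝ) {x : ℝ} (hx : 0 < x) :
    besselI μ x = (x / 2) ^ μ * besselSeries μ (x ^ 2 / 4) := by
  rw [besselI, besselSeries, ← tsum_mul_left]
  refine tsum_congr fun k => ?_
  rw [Real.rpow_add (by positivity), ← mul_div_assoc, show (2 : ℝ) * k = ((2 * k : ℕ) : ℝ) by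
    push_cast; ring, Real.rpow_natCast, pow_mul, div_pow]
  norm_num

/-- Comparison of a positive increasing solution `h` of `q h₂ + (μ + 1) h₁ = c h`, where
`h₁` and `h₂` are the first two derivatives of `h`, with an
approximate solution `exp g`: the one-sided residual bound on `g` controls `log h - g`, scaled
by `σ`. -/
theorem log_sub_le_of_residual_le {h h₁ h₂ g g₁ g₂ : ℝ → ℝ} {μ c K σ q₀ : ℝ} (hμ : 0 < μ)
    (hK : 0 ≤ K) (hq₀ : 0 ≤ q₀)
    (hh : ∀ q, 0 ≤ q → HasDerivAt h (h₁ q) q) (hh₁ : ∀ q, 0 ≤ q → HasDerivAt h₁ (h₂ q) q)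
    (hg : ∀ q, 0 ≤ q → HasDerivAt g (g₁ q) q) (hg₁ : ∀ q, 0 ≤ q → HasDerivAt g₁ (g₂ q) q)
    (hpos : ∀ q, 0 ≤ q → 0 < h q) (hpos₁ : ∀ q, 0 ≤ q → 0 ≤ h₁ q)
    (hode : ∀ q, 0 ≤ q → q * h₂ q + (μ + 1) * h₁ q = c * h q)
    (hres : ∀ q, 0 ≤ q → q ≤ q₀ →
      -σ * (q * (g₂ q + g₁ q ^ 2) + (μ + 1) * g₁ q - c) ≤ K * (μ + 1 + q * g₁ q)) :
    σ * (Real.log (h q₀) - g q₀) - K * q₀ ≤ σ * (Real.log (h 0) - g 0) := by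
  let Φ : ℝ → ℝ := fun q =>
    q ^ (μ + 1) * (Real.exp (g q) * (σ * (h₁ q - h q * g₁ q) - K * h q))
  have hΦ : AntitoneOn Φ (Set.Icc 0 q₀) := by
    refine antitoneOn_of_hasDerivWithinAt_nonpos (convex_Icc 0 q₀)
      (f' := fun q => q ^ μ * Real.exp (g q) *
        (-σ * (q * (g₂ q + g₁ q ^ 2) + (μ + 1) * g₁ q - c) * h q
          - K * (μ + 1 + q * g₁ q) * h q - K * q * h₁ q)) ?_ ?_ ?_
    · intro q hq
      have c1 := (hh q hq.1).continuousAt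
      have c2 := (hh₁ q hq.1).continuousAt
      have c3 := (hg q hq.1).continuousAt
      have c4 := (hg₁ q hq.1).continuousAt
      have c5 : ContinuousAt (fun q : ℝ => q ^ (μ + 1)) q :=
        Real.continuousAt_rpow_const _ _ (Or.inr (by linarith))
      have : ContinuousAt Φ q := by fun_prop
      exact this.continuousWithinAt
    · intro q hq
      rw [interior_Icc] at hq
      have hq0 : 0 ≤ q := hq.1.le
      refine HasDerivAt.hasDerivWithinAt ?_
      have d := ((Real.hasDerivAt_rpow_const (p := μ + 1) (Or.inl hq.1.ne')).mul
        ((hg q hq0).exp.mul ((((hh₁ q hq0).sub ((hh q hq0).mul (hg₁ q hq0))).const_mul σ).sub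
          ((hh q hq0).const_mul K))))
      refine d.congr_deriv ?_
      rw [Real.rpow_add hq.1, Real.rpow_one, add_sub_cancel_right]
      simp only [Pi.mul_apply, Pi.sub_apply]
      linear_combination (q ^ μ * Real.exp (g q) * σ) * hode q hq0
    · intro q hq
      rw [interior_Icc] at hq
      have hq0 : 0 ≤ q := hq.1.le
      have r := mul_le_mul_of_nonneg_right (hres q hq0 hq.2.le) (hpos q hq0).le
      have s : 0 ≤ K * q * h₁ q := mul_nonneg (mul_nonneg hK hq0) (hpos₁ q hq0)
      exact mul_nonpos_of_nonneg_of_nonpos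
        (mul_nonneg (Real.rpow_nonneg hq0 _) (Real.exp_pos _).le) (by linarith)
  have hΦ₀ : Φ 0 = 0 := by
    simp only [Φ]
    rw [Real.zero_rpow (by linarith), zero_mul]
  have hanti : AntitoneOn (fun q => σ * (Real.log (h q) - g q) - K * q) (Set.Icc 0 q₀) := by
    refine antitoneOn_of_hasDerivWithinAt_nonpos (convex_Icc 0 q₀)
      (f' := fun q => σ * (h₁ q / h q - g₁ q) - K * 1) ?_ ?_ ?_
    · intro q hq
      have d := ((((hh q hq.1).log (hpos q hq.1).ne').sub (hg q hq.1)).const_mul σ).sub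
        ((hasDerivAt_id q).const_mul K)
      exact d.continuousAt.continuousWithinAt
    · intro q hq
      rw [interior_Icc] at hq
      have hq0 := hq.1.le
      exact (((((hh q hq0).log (hpos q hq0).ne').sub (hg q hq0)).const_mul σ).sub
        ((hasDerivAt_id q).const_mul K)).hasDerivWithinAt
    · intro q hq
      rw [interior_Icc] at hq
      have hle := hΦ (Set.left_mem_Icc.mpr hq₀) (Set.Ioo_subset_Icc_self hq) hq.1.le
      rw [hΦ₀] at hle
      have hh0 := hpos q hq.1.le
      have hleZero : σ * (h₁ q - h q * g₁ q) - K * h q ≤ 0 := by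
        by_contra hneg
        have : 0 < Φ q :=
          mul_pos (Real.rpow_pos_of_pos hq.1 _) (mul_pos (Real.exp_pos _) (not_le.mp hneg))
        linarith
      have heq : σ * (h₁ q / h q - g₁ q) - K * 1 =
          (σ * (h₁ q - h q * g₁ q) - K * h q) / h q := by
        field_simp
      rw [heq]
      exact div_nonpos_of_nonpos_of_nonneg hleZero hh0.le
  have := hanti (Set.left_mem_Icc.mpr hq₀) (Set.right_mem_Icc.mpr hq₀) hq₀
  simpa using this

/-- The derivative of `debyeC₁` in `t`. -/
noncomputable def debyeD₁ (α t : ℝ) : ℝ :=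
  1 / 8 - α ^ 2 / 2 - α * t - 5 * t ^ 2 / 8

/-- The derivative of `debyeC₂` in `t`. -/
noncomputable def debyeD₂ (α t : ℝ) : ℝ :=
  t / 8 - α ^ 2 * t / 2 - 13 * α * t ^ 2 / 8 + α ^ 3 * t ^ 2 / 2 -
    3 * t ^ 3 / 2 + 2 * α ^ 2 * t ^ 3 + 25 * α * t ^ 4 / 8 + 15 * t ^ 5 / 8

/-- The derivative of `debyeC₃` in `t`. -/
noncomputable def debyeD₃ (α t : ℝ) : ℝ :=
  25 * t ^ 2 / 128 - 13 * α ^ 2 * t ^ 2 / 16 + α ^ 4 * t ^ 2 / 8 -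
    7 * α * t ^ 3 / 2 + 2 * α ^ 3 * t ^ 3 - 531 * t ^ 4 / 128 + 35 * α ^ 2 * t ^ 4 / 4 -
    5 * α ^ 4 * t ^ 4 / 8 + 33 * α * t ^ 5 / 2 - 4 * α ^ 3 * t ^ 5 + 1547 * t ^ 6 / 128 -
    175 * α ^ 2 * t ^ 6 / 16 - 15 * α * t ^ 7 - 1105 * t ^ 8 / 128

/-- The second derivative of `debyeC₁` in `t`. -/
noncomputable def debyeDD₁ (α t : ℝ) : ℝ :=
  -α - 5 * t / 4

/-- The second derivative of `debyeC₂` in `t`. -/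
noncomputable def debyeDD₂ (α t : ℝ) : ℝ :=
  1 / 8 - α ^ 2 / 2 - 13 * α * t / 4 + α ^ 3 * t -
    9 * t ^ 2 / 2 + 6 * α ^ 2 * t ^ 2 + 25 * α * t ^ 3 / 2 + 75 * t ^ 4 / 8

/-- The second derivative of `debyeC₃` in `t`. -/
noncomputable def debyeDD₃ (α t : ℝ) : ℝ :=
  25 * t / 64 - 13 * α ^ 2 * t / 8 + α ^ 4 * t / 4 -
    21 * α * t ^ 2 / 2 + 6 * α ^ 3 * t ^ 2 - 531 * t ^ 3 / 32 + 35 * α ^ 2 * t ^ 3 -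
    5 * α ^ 4 * t ^ 3 / 2 + 165 * α * t ^ 4 / 2 - 20 * α ^ 3 * t ^ 4 + 4641 * t ^ 5 / 64 -
    525 * α ^ 2 * t ^ 5 / 8 - 105 * α * t ^ 6 - 1105 * t ^ 7 / 16

theorem hasDerivAt_mul_pow (c : ℝ) (n : ℕ) (t : ℝ) :
    HasDerivAt (fun t : ℝ => c * t ^ n) (c * (n * t ^ (n - 1))) t :=
  (hasDerivAt_pow n t).const_mul c

theorem hasDerivAt_debyeC₁ (α t : ℝ) : HasDerivAt (debyeC₁ α) (debyeD₁ α t) t := by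
  have d := ((hasDerivAt_mul_pow (1 / 8 - α ^ 2 / 2) 1 t).add
    (hasDerivAt_mul_pow (-α / 2) 2 t)).add (hasDerivAt_mul_pow (-5 / 24) 3 t)
  refine (d.congr_deriv ?_).congr_of_eventuallyEq (.of_forall fun x => ?_)
  · simp only [debyeD₁]
    push_cast
    ring
  · simp only [debyeC₁, Pi.add_apply]
    ring

theorem hasDerivAt_debyeD₁ (α t : ℝ) : HasDerivAt (debyeD₁ α) (debyeDD₁ α t) t := by
  have d := ((hasDerivAt_mul_pow (1 / 8 - α ^ 2 / 2) 0 t).add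
    (hasDerivAt_mul_pow (-α) 1 t)).add (hasDerivAt_mul_pow (-5 / 8) 2 t)
  refine (d.congr_deriv ?_).congr_of_eventuallyEq (.of_forall fun x => ?_)
  · simp only [debyeDD₁]
    push_cast
    ring
  · simp only [debyeD₁, Pi.add_apply]
    ring

theorem hasDerivAt_debyeC₂ (α t : ℝ) : HasDerivAt (debyeC₂ α) (debyeD₂ α t) t := by
  have d := ((((hasDerivAt_mul_pow (1 / 16 - α ^ 2 / 4) 2 t).add
    (hasDerivAt_mul_pow (-13 * α / 24 + α ^ 3 / 6) 3 t)).add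
    (hasDerivAt_mul_pow (-3 / 8 + α ^ 2 / 2) 4 t)).add
    (hasDerivAt_mul_pow (5 * α / 8) 5 t)).add (hasDerivAt_mul_pow (5 / 16) 6 t)
  refine (d.congr_deriv ?_).congr_of_eventuallyEq (.of_forall fun x => ?_)
  · simp only [debyeD₂]
    push_cast
    ring
  · simp only [debyeC₂, Pi.add_apply]
    ring

theorem hasDerivAt_debyeD₂ (α t : ℝ) : HasDerivAt (debyeD₂ α) (debyeDD₂ α t) t := by
  have d := ((((hasDerivAt_mul_pow (1 / 8 - α ^ 2 / 2) 1 t).add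
    (hasDerivAt_mul_pow (-13 * α / 8 + α ^ 3 / 2) 2 t)).add
    (hasDerivAt_mul_pow (-3 / 2 + 2 * α ^ 2) 3 t)).add
    (hasDerivAt_mul_pow (25 * α / 8) 4 t)).add (hasDerivAt_mul_pow (15 / 8) 5 t)
  refine (d.congr_deriv ?_).congr_of_eventuallyEq (.of_forall fun x => ?_)
  · simp only [debyeDD₂]
    push_cast
    ring
  · simp only [debyeD₂, Pi.add_apply]
    ring

theorem hasDerivAt_debyeC₃ (α t : ℝ) : HasDerivAt (debyeC₃ α) (debyeD₃ α t) t := by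
  have d := ((((((hasDerivAt_mul_pow (25 / 384 - 13 * α ^ 2 / 48 + α ^ 4 / 24) 3 t).add
    (hasDerivAt_mul_pow (-7 * α / 8 + α ^ 3 / 2) 4 t)).add
    (hasDerivAt_mul_pow (-531 / 640 + 7 * α ^ 2 / 4 - α ^ 4 / 8) 5 t)).add
    (hasDerivAt_mul_pow (11 * α / 4 - 2 * α ^ 3 / 3) 6 t)).add
    (hasDerivAt_mul_pow (221 / 128 - 25 * α ^ 2 / 16) 7 t)).add
    (hasDerivAt_mul_pow (-15 * α / 8) 8 t)).add (hasDerivAt_mul_pow (-1105 / 1152) 9 t)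
  refine (d.congr_deriv ?_).congr_of_eventuallyEq (.of_forall fun x => ?_)
  · simp only [debyeD₃]
    push_cast
    ring
  · simp only [debyeC₃, Pi.add_apply]
    ring

theorem hasDerivAt_debyeD₃ (α t : ℝ) : HasDerivAt (debyeD₃ α) (debyeDD₃ α t) t := by
  have d := ((((((hasDerivAt_mul_pow (25 / 128 - 13 * α ^ 2 / 16 + α ^ 4 / 8) 2 t).add
    (hasDerivAt_mul_pow (-7 * α / 2 + 2 * α ^ 3) 3 t)).add
    (hasDerivAt_mul_pow (-531 / 128 + 35 * α ^ 2 / 4 - 5 * α ^ 4 / 8) 4 t)).add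
    (hasDerivAt_mul_pow (33 * α / 2 - 4 * α ^ 3) 5 t)).add
    (hasDerivAt_mul_pow (1547 / 128 - 175 * α ^ 2 / 16) 6 t)).add
    (hasDerivAt_mul_pow (-15 * α) 7 t)).add (hasDerivAt_mul_pow (-1105 / 128) 8 t)
  refine (d.congr_deriv ?_).congr_of_eventuallyEq (.of_forall fun x => ?_)
  · simp only [debyeDD₃]
    push_cast
    ring
  · simp only [debyeD₃, Pi.add_apply]
    ring

/-- The logarithm of the Debye approximation to `z ^ (-(ν + α)) * I_{ν+α}(ν z)`, up to a factor
independent of `z`, as a function of `t = (1 + z²)^(-1/2)`. -/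
noncomputable def debyePhase (α ν t : ℝ) : ℝ :=
  ν / t + (ν + α) * (Real.log t - Real.log (1 + t)) + Real.log t / 2 + debyeExponent α ν t

/-- The derivative of `debyePhase` with respect to `q = z²`. -/
noncomputable def debyeSlope (α ν t : ℝ) : ℝ :=
  ν * t / (2 * (1 + t)) - α * t ^ 2 / (2 * (1 + t)) - t ^ 2 / 4 -
    t ^ 3 / 2 * (debyeD₁ α t / ν + debyeD₂ α t / ν ^ 2 + debyeD₃ α t / ν ^ 3)

/-- The derivative of `debyeSlope` with respect to `q = z²`. -/
noncomputable def debyeSlopeDeriv (α ν t : ℝ) : ℝ :=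
  -t ^ 3 / 2 * (ν / (2 * (1 + t) ^ 2) - α * (2 * t + t ^ 2) / (2 * (1 + t) ^ 2) - t / 2 -
    3 * t ^ 2 / 2 * (debyeD₁ α t / ν + debyeD₂ α t / ν ^ 2 + debyeD₃ α t / ν ^ 3) -
    t ^ 3 / 2 * (debyeDD₁ α t / ν + debyeDD₂ α t / ν ^ 2 + debyeDD₃ α t / ν ^ 3))

theorem hasDerivAt_inv_sqrt_one_add {q : ℝ} (hq : 0 ≤ q) :
    HasDerivAt (fun q : ℝ => (√(1 + q))⁻¹) (-(√(1 + q))⁻¹ ^ 3 / 2) q := by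
  have hs : 0 < √(1 + q) := Real.sqrt_pos.mpr (by linarith)
  have d := (((hasDerivAt_id q).const_add 1).sqrt (by simp; linarith)).inv hs.ne'
  refine d.congr_deriv ?_
  simp only [id]
  field_simp

theorem hasDerivAt_debyePhase_comp (α ν : ℝ) {T : ℝ → ℝ} {q : ℝ} (hT : 0 < T q)
    (hd : HasDerivAt T (-(T q) ^ 3 / 2) q) :
    HasDerivAt (fun q => debyePhase α ν (T q)) (debyeSlope α ν (T q)) q := by
  have hexp : HasDerivAt (fun q => debyeExponent α ν (T q)) _ q :=
    ((((hasDerivAt_debyeC₁ α (T q)).comp q hd).div_const ν).add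
      (((hasDerivAt_debyeC₂ α (T q)).comp q hd).div_const (ν ^ 2))).add
      (((hasDerivAt_debyeC₃ α (T q)).comp q hd).div_const (ν ^ 3))
  have hlog := hd.log hT.ne'
  have hlogOne := (hd.const_add 1).log (by positivity)
  have d := ((((hasDerivAt_const q ν).div hd hT.ne').add
    ((hlog.sub hlogOne).const_mul (ν + α))).add (hlog.div_const 2)).add hexp
  refine d.congr_deriv ?_
  simp only [debyeSlope]
  field_simp
  ring

theorem hasDerivAt_debyeSlope_comp (α ν : ℝ) {T : ℝ → ℝ} {q : ℝ} (hT : 0 < T q)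
    (hd : HasDerivAt T (-(T q) ^ 3 / 2) q) :
    HasDerivAt (fun q => debyeSlope α ν (T q)) (debyeSlopeDeriv α ν (T q)) q := by
  have h2 : 2 * (1 + T q) ≠ 0 := by positivity
  have hsum : HasDerivAt (fun t => debyeD₁ α t / ν + debyeD₂ α t / ν ^ 2 + debyeD₃ α t / ν ^ 3)
      (debyeDD₁ α (T q) / ν + debyeDD₂ α (T q) / ν ^ 2 + debyeDD₃ α (T q) / ν ^ 3) (T q) :=
    (((hasDerivAt_debyeD₁ α (T q)).div_const ν).add
      ((hasDerivAt_debyeD₂ α (T q)).div_const (ν ^ 2))).add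
      ((hasDerivAt_debyeD₃ α (T q)).div_const (ν ^ 3))
  have hden := ((hasDerivAt_id (T q)).const_add 1).const_mul 2
  have d : HasDerivAt (debyeSlope α ν) _ (T q) :=
    (((((hasDerivAt_id (T q)).const_mul ν).div hden h2).sub
      (((hasDerivAt_pow 2 (T q)).const_mul α).div hden h2)).sub
      ((hasDerivAt_pow 2 (T q)).div_const 4)).sub
      (((hasDerivAt_pow 3 (T q)).div_const 2).mul hsum)
  refine (d.comp q hd).congr_deriv ?_
  simp only [debyeSlopeDeriv, id]
  generalize debyeD₁ α (T q) / ν + debyeD₂ α (T q) / ν ^ 2 + debyeD₃ α (T q) / ν ^ 3 = A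
  generalize debyeDD₁ α (T q) / ν + debyeDD₂ α (T q) / ν ^ 2 + debyeDD₃ α (T q) / ν ^ 3 = B
  push_cast
  field_simp
  ring

/-- The residual of the Debye approximation in the Bessel equation, multiplied by `ν³` and written
in terms of `q = z²`, `t` and `x = 1/ν`. -/
noncomputable def debyeResidual (α q t x : ℝ) : ℝ :=
  q * (t ^ 3 / 4 * (3 * t ^ 2 * debyeD₃ α t + t ^ 3 * debyeDD₃ α t) +
      t ^ 3 * (α * t ^ 2 / (2 * (1 + t)) + t ^ 2 / 4) * debyeD₃ α t +
      t ^ 6 / 2 * (debyeD₁ α t * debyeD₂ α t)) - (α + 1) * (t ^ 3 / 2 * debyeD₃ α t) +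
    q * t ^ 6 / 4 * ((debyeD₂ α t ^ 2 + 2 * (debyeD₁ α t * debyeD₃ α t)) * x +
      2 * (debyeD₂ α t * debyeD₃ α t) * x ^ 2 + debyeD₃ α t ^ 2 * x ^ 3)

theorem debyeSlope_riccati {α ν q t : ℝ} (hν : 0 < ν) (ht : 0 < t) (hq : q = (1 - t ^ 2) / t ^ 2) :
    q * (debyeSlopeDeriv α ν t + debyeSlope α ν t ^ 2) + (ν + α + 1) * debyeSlope α ν t -
        ν ^ 2 / 4 =
      debyeResidual α q t ν⁻¹ / ν ^ 3 := by
  subst hq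
  simp only [debyeSlope, debyeSlopeDeriv, debyeResidual, debyeD₁, debyeD₂, debyeD₃, debyeDD₁,
    debyeDD₂, debyeDD₃]
  field_simp
  ring

theorem exists_abs_le_of_continuousOn_box {f : ℝ × ℝ × ℝ → ℝ} (b : ℝ)
    (hf : ContinuousOn f (Set.Icc 0 b ×ˢ Set.Icc 0 1 ×ˢ Set.Icc 0 1)) :
    ∃ M, 0 ≤ M ∧ ∀ q t x, q ∈ Set.Icc 0 b → t ∈ Set.Icc (0 : ℝ) 1 → x ∈ Set.Icc (0 : ℝ) 1 →
      |f (q, t, x)| ≤ M := by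
  obtain ⟨M, hM⟩ :=
    (isCompact_Icc.prod (isCompact_Icc.prod isCompact_Icc)).exists_bound_of_continuousOn hf
  exact ⟨max M 0, le_max_right _ _, fun q t x hq ht hx =>
    (hM (q, t, x) ⟨hq, ht, hx⟩).trans (le_max_left _ _)⟩

theorem exists_abs_debyeResidual_le (α b : ℝ) :
    ∃ M, 0 ≤ M ∧ ∀ q t x, q ∈ Set.Icc 0 b → t ∈ Set.Icc (0 : ℝ) 1 → x ∈ Set.Icc (0 : ℝ) 1 →
      |debyeResidual α q t x| ≤ M := by
  refine exists_abs_le_of_continuousOn_box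
    (f := fun p => debyeResidual α p.1 p.2.1 p.2.2) b fun p hp => ContinuousAt.continuousWithinAt ?_
  have h0 : 2 * (1 + p.2.1) ≠ 0 := by
    have := hp.2.1.1
    positivity
  simp only [debyeResidual, debyeD₁, debyeD₂, debyeD₃, debyeDD₃]
  fun_prop (disch := assumption)

theorem exists_le_mul_debyeSlope (α b : ℝ) :
    ∃ M, ∀ q t ν, q ∈ Set.Icc 0 b → t ∈ Set.Icc (0 : ℝ) 1 → 1 ≤ ν →
      -M ≤ q * debyeSlope α ν t := by
  obtain ⟨M, -, hM⟩ := exists_abs_le_of_continuousOn_box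
    (f := fun p : ℝ × ℝ × ℝ => p.1 * (α * p.2.1 ^ 2 / (2 * (1 + p.2.1)) + p.2.1 ^ 2 / 4 +
      p.2.1 ^ 3 / 2 * (debyeD₁ α p.2.1 * p.2.2 + debyeD₂ α p.2.1 * p.2.2 ^ 2 +
        debyeD₃ α p.2.1 * p.2.2 ^ 3))) b fun p hp => by
      have h0 : 2 * (1 + p.2.1) ≠ 0 := by
        have := hp.2.1.1
        positivity
      refine ContinuousAt.continuousWithinAt ?_
      simp only [debyeD₁, debyeD₂, debyeD₃]
      fun_prop (disch := assumption)
  refine ⟨M, fun q t ν hq ht hν => ?_⟩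
  have h := (abs_le.mp (hM q t ν⁻¹ hq ht ⟨by positivity, inv_le_one_of_one_le₀ hν⟩)).2
  have hnonneg : 0 ≤ q * (ν * t / (2 * (1 + t))) := by
    have := hq.1
    have := ht.1
    positivity
  have heq : q * debyeSlope α ν t = q * (ν * t / (2 * (1 + t))) -
      q * (α * t ^ 2 / (2 * (1 + t)) + t ^ 2 / 4 + t ^ 3 / 2 *
        (debyeD₁ α t * ν⁻¹ + debyeD₂ α t * ν⁻¹ ^ 2 + debyeD₃ α t * ν⁻¹ ^ 3)) := by
    rw [debyeSlope]
    simp only [div_eq_mul_inv _ ν, div_eq_mul_inv _ (ν ^ 2), div_eq_mul_inv _ (ν ^ 3), ← inv_pow]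
    ring
  simp only at h
  linarith

/-- The logarithm of the Bessel series follows the Debye phase up to `O(ν⁻⁴)` along `[0, q₀]`. -/
theorem isBigO_log_besselSeries_sub_debyePhase (α : ℝ) {q₀ : ℝ} (hq₀ : 0 ≤ q₀) :
    (fun ν : ℝ => (Real.log (besselSeries (ν + α) (ν ^ 2 / 4 * q₀)) -
        debyePhase α ν (√(1 + q₀))⁻¹) -
      (Real.log (besselSeries (ν + α) 0) - debyePhase α ν 1)) =O[atTop]
      fun ν : ℝ => 1 / ν ^ 4 := by
  obtain ⟨M, hM0, hM⟩ := exists_abs_debyeResidual_le α q₀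
  obtain ⟨B, hB⟩ := exists_le_mul_debyeSlope α q₀
  refine Asymptotics.IsBigO.of_bound (2 * M * q₀) ?_
  filter_upwards [eventually_ge_atTop 1, eventually_gt_atTop (-α),
    eventually_ge_atTop (2 * (B - α - 1))] with ν hν hα hνB
  have hν0 : 0 < ν := by linarith
  have hμ : 0 < ν + α := by linarith
  set c := ν ^ 2 / 4 with hc
  have hc0 : 0 < c := by positivity
  let T : ℝ → ℝ := fun q => (√(1 + q))⁻¹
  have hT0 : ∀ q, 0 ≤ q → 0 < T q := fun q hq =>
    inv_pos.mpr (Real.sqrt_pos.mpr (by linarith))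
  have hT1 : ∀ q, 0 ≤ q → T q ≤ 1 := fun q hq =>
    inv_le_one_of_one_le₀ (Real.one_le_sqrt.mpr (by linarith))
  have hTq : ∀ q, 0 ≤ q → q = (1 - T q ^ 2) / T q ^ 2 := by
    intro q hq
    have : T q ^ 2 = (1 + q)⁻¹ := by
      simp only [T]
      rw [inv_pow, Real.sq_sqrt (by linarith)]
    rw [this]
    field_simp
    ring
  have hTd : ∀ q, 0 ≤ q → HasDerivAt T (-(T q) ^ 3 / 2) q := fun q hq =>
    hasDerivAt_inv_sqrt_one_add hq
  have hscale : ∀ q : ℝ, HasDerivAt (fun q => c * q) c q := fun q => by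
    simpa using (hasDerivAt_id q).const_mul c
  have hK : 0 ≤ 2 * M / ν ^ 4 := by positivity
  have hcmp : ∀ σ : ℝ, |σ| = 1 →
      σ * (Real.log (besselSeries (ν + α) (c * q₀)) - debyePhase α ν (T q₀)) -
        2 * M / ν ^ 4 * q₀ ≤
      σ * (Real.log (besselSeries (ν + α) (c * 0)) - debyePhase α ν (T 0)) := by
    intro σ hσ
    refine log_sub_le_of_residual_le (h := fun q => besselSeries (ν + α) (c * q))
      (h₁ := fun q => besselSeries (ν + α + 1) (c * q) * c)
      (h₂ := fun q => besselSeries (ν + α + 1 + 1) (c * q) * c * c)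
      (g := fun q => debyePhase α ν (T q)) (g₁ := fun q => debyeSlope α ν (T q))
      (g₂ := fun q => debyeSlopeDeriv α ν (T q)) (c := c) hμ hK hq₀
      (fun q _ => (hasDerivAt_besselSeries hμ.le _).comp q (hscale q))
      (fun q _ => ((hasDerivAt_besselSeries (by linarith) _).comp q (hscale q)).mul_const c)
      (fun q hq => hasDerivAt_debyePhase_comp α ν (hT0 q hq) (hTd q hq))
      (fun q hq => hasDerivAt_debyeSlope_comp α ν (hT0 q hq) (hTd q hq))
      (fun q hq => besselSeries_pos hμ.le (by positivity))
      (fun q hq => (mul_pos (besselSeries_pos (by linarith) (by positivity)) hc0).le)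
      (fun q _ => ?_) (fun q hq hqq => ?_)
    · rw [← besselSeries_recurrence hμ.le (c * q), add_assoc (ν + α) 1 1, one_add_one_eq_two]
      ring
    · rw [hc, debyeSlope_riccati hν0 (hT0 q hq) (hTq q hq)]
      have hTm : T q ∈ Set.Icc (0 : ℝ) 1 := ⟨(hT0 q hq).le, hT1 q hq⟩
      have hr := hM q (T q) ν⁻¹ ⟨hq, hqq⟩ hTm ⟨by positivity, inv_le_one_of_one_le₀ hν⟩
      have hs := hB q (T q) ν ⟨hq, hqq⟩ hTm hν
      calc -σ * (debyeResidual α q (T q) ν⁻¹ / ν ^ 3)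
          ≤ |-σ * (debyeResidual α q (T q) ν⁻¹ / ν ^ 3)| := le_abs_self _
        _ = |debyeResidual α q (T q) ν⁻¹| / ν ^ 3 := by
            rw [abs_mul, abs_neg, hσ, one_mul, abs_div, abs_of_pos (pow_pos hν0 3)]
        _ ≤ M / ν ^ 3 := by gcongr
        _ = 2 * M / ν ^ 4 * (ν / 2) := by field_simp
        _ ≤ 2 * M / ν ^ 4 * (ν + α + 1 + q * debyeSlope α ν (T q)) := by
            gcongr
            linarith
  have h1 := hcmp 1 (by simp)
  have h2 := hcmp (-1) (by simp)
  have hT00 : T 0 = 1 := by simp [T]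
  rw [mul_zero, hT00] at h1 h2
  rw [Real.norm_eq_abs, Real.norm_of_nonneg (by positivity),
    show 2 * M * q₀ * (1 / ν ^ 4) = 2 * M / ν ^ 4 * q₀ by ring, abs_le]
  constructor <;> linarith

theorem debyePhase_one (α ν : ℝ) :
    debyePhase α ν 1 = ν - (ν + α) * Real.log 2 + debyeExponent α ν 1 := by
  simp only [debyePhase, Real.log_one]
  norm_num
  ring

/-- The exact logarithm of the normalised Bessel function, split into the Debye exponent and two
remainders. -/
theorem normalized_besselI_eq_exp {z α t β ν : ℝ} (hz : 0 < z) (ht : t = (√(1 + z ^ 2))⁻¹)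
    (hβ : β = √(1 + z ^ 2) + Real.log (z / (1 + √(1 + z ^ 2))))
    (hν : 0 < ν) (hα : 0 < ν + α) :
    √(2 * π * ν) * Real.exp (-ν * β) * t ^ (-(1 / 2) : ℝ) * ((1 + t) / (1 - t)) ^ (α / 2) *
        besselI (ν + α) (ν * z) =
      Real.exp (debyeExponent α ν t) *
        Real.exp ((Real.log (besselSeries (ν + α) (ν ^ 2 / 4 * z ^ 2)) - debyePhase α ν t) -
          (Real.log (besselSeries (ν + α) 0) - debyePhase α ν 1) - stirlingRemainder α ν) := by
  have hπ := Real.pi_pos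
  have hs1 : 1 < √(1 + z ^ 2) := Real.lt_sqrt_of_sq_lt (by nlinarith)
  have hst : √(1 + z ^ 2) = t⁻¹ := by rw [ht, inv_inv]
  have ht0 : 0 < t := by rw [ht]; positivity
  have ht1 : t < 1 := by rw [ht]; exact inv_lt_one_of_one_lt₀ hs1
  have htz : t ^ 2 * z ^ 2 = 1 - t ^ 2 := by
    have : t⁻¹ ^ 2 = 1 + z ^ 2 := by rw [← hst, Real.sq_sqrt (by positivity)]
    field_simp at this
    linarith
  have hratio : (1 + t) / (1 - t) = ((1 + t) / (z * t)) ^ 2 := by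
    have : 1 - t ≠ 0 := by linarith
    rw [div_pow, div_eq_div_iff this (by positivity)]
    linear_combination (1 + t) * htz
  have hlog : Real.log ((1 + t) / (1 - t)) =
      2 * (Real.log (1 + t) - (Real.log z + Real.log t)) := by
    rw [hratio, Real.log_pow, Real.log_div (by positivity) (by positivity),
      Real.log_mul hz.ne' ht0.ne']
    norm_num
  have hβt : β = t⁻¹ + (Real.log z + Real.log t - Real.log (1 + t)) := by
    rw [hβ, hst, show z / (1 + t⁻¹) = z * t / (1 + t) by field_simp; ring,
      Real.log_div (by positivity) (by positivity), Real.log_mul hz.ne' ht0.ne']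
  have hH : 0 < besselSeries (ν + α) (ν ^ 2 / 4 * z ^ 2) := besselSeries_pos hα.le (by positivity)
  have hr : 0 < (1 + t) / (1 - t) := div_pos (by linarith) (by linarith)
  rw [besselI_eq_rpow_mul_besselSeries _ (by positivity),
    show (ν * z) ^ 2 / 4 = ν ^ 2 / 4 * z ^ 2 by ring, ← Real.exp_add]
  have e1 : √(2 * π * ν) = Real.exp ((Real.log (2 * π) + Real.log ν) / 2) := by
    rw [← Real.log_mul (by positivity) hν.ne', ← Real.log_sqrt (by positivity),
      Real.exp_log (by positivity)]
  have e2 : (ν * z / 2) ^ (ν + α) =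
      Real.exp ((Real.log ν + Real.log z - Real.log 2) * (ν + α)) := by
    rw [Real.rpow_def_of_pos (by positivity), Real.log_div (by positivity) (by norm_num),
      Real.log_mul hν.ne' hz.ne']
  rw [e1, e2, Real.rpow_def_of_pos ht0, Real.rpow_def_of_pos hr, hlog]
  nth_rewrite 1 [← Real.exp_log hH]
  simp only [← Real.exp_add]
  congr 1
  rw [besselSeries_zero, Real.log_inv, debyePhase_one, hβt, stirlingRemainder, debyePhase]
  ring

/-- the shifted Debye expansion of `I_{ν+α}(νz)`: as `ν → ∞`,
`√(2πν) e^{−νβ} t^{−1/2} ((1+t)/(1−t))^{α/2} I_{ν+α}(νz) = exp(C₁/ν + C₂/ν² + C₃/ν³) + O(ν^{−4})`. -/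
theorem stmt_15 (z α t β C1 C2 C3 : ℝ) (hz : 0 < z)
    (ht : t = (1 + z ^ 2) ^ (-(1 / 2) : ℝ))
    (hβ : β = Real.sqrt (1 + z ^ 2) + Real.log (z / (1 + Real.sqrt (1 + z ^ 2))))
    (hC1 : C1 = t / 8 - α ^ 2 * t / 2 - α * t ^ 2 / 2 - 5 * t ^ 3 / 24)
    (hC2 : C2 = t ^ 2 / 16 - α ^ 2 * t ^ 2 / 4 - 13 * α * t ^ 3 / 24 + α ^ 3 * t ^ 3 / 6 -
      3 * t ^ 4 / 8 + α ^ 2 * t ^ 4 / 2 + 5 * α * t ^ 5 / 8 + 5 * t ^ 6 / 16)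
    (hC3 : C3 = 25 * t ^ 3 / 384 - 13 * α ^ 2 * t ^ 3 / 48 + α ^ 4 * t ^ 3 / 24 -
      7 * α * t ^ 4 / 8 + α ^ 3 * t ^ 4 / 2 - 531 * t ^ 5 / 640 + 7 * α ^ 2 * t ^ 5 / 4 -
      α ^ 4 * t ^ 5 / 8 + 11 * α * t ^ 6 / 4 - 2 * α ^ 3 * t ^ 6 / 3 + 221 * t ^ 7 / 128 -
      25 * α ^ 2 * t ^ 7 / 16 - 15 * α * t ^ 8 / 8 - 1105 * t ^ 9 / 1152) :
    (fun ν : ℝ =>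
        Real.sqrt (2 * π * ν) * Real.exp (-ν * β) * t ^ (-(1 / 2) : ℝ) *
            ((1 + t) / (1 - t)) ^ (α / 2) * besselI (ν + α) (ν * z) -
          Real.exp (C1 / ν + C2 / ν ^ 2 + C3 / ν ^ 3))
      =O[atTop] fun ν : ℝ => ν ^ (-(4 : ℝ)) := by
  have htinv : t = (√(1 + z ^ 2))⁻¹ := by
    rw [ht, Real.rpow_neg (by positivity), Real.sqrt_eq_rpow]
  have hexponent : ∀ ν, C1 / ν + C2 / ν ^ 2 + C3 / ν ^ 3 = debyeExponent α ν t := fun ν => by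
    rw [hC1, hC2, hC3, debyeExponent, debyeC₁, debyeC₂, debyeC₃]
  let E : ℝ → ℝ := fun ν =>
    (Real.log (besselSeries (ν + α) (ν ^ 2 / 4 * z ^ 2)) - debyePhase α ν t) -
      (Real.log (besselSeries (ν + α) 0) - debyePhase α ν 1) - stirlingRemainder α ν
  have hE : E =O[atTop] fun ν : ℝ => 1 / ν ^ 4 := by
    have h := isBigO_log_besselSeries_sub_debyePhase α (sq_nonneg z)
    rw [← htinv] at h
    exact h.sub (isBigO_stirlingRemainder α)
  have hE0 : Tendsto E atTop (nhds 0) :=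
    hE.trans_tendsto (tendsto_const_nhds.div_atTop (tendsto_pow_atTop four_ne_zero))
  have hexpE : (fun ν => Real.exp (E ν) - 1) =O[atTop] fun ν : ℝ => 1 / ν ^ 4 := by
    have h := ((Real.hasDerivAt_exp 0).isBigO_sub.comp_tendsto hE0).trans
      ((hE.congr_left fun ν => (sub_zero (E ν)).symm))
    simpa [Function.comp_def] using h
  have hbdd : (fun ν => Real.exp (debyeExponent α ν t)) =O[atTop] fun _ => (1 : ℝ) :=
    ((Real.continuous_exp.tendsto 0).comp (tendsto_debyeExponent_atTop α t)).isBigO_one ℝ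
  refine (hbdd.mul hexpE).congr' ?_ ?_
  · filter_upwards [eventually_gt_atTop 0, eventually_gt_atTop (-α)] with ν hν hα
    rw [hexponent, normalized_besselI_eq_exp hz htinv hβ hν (by linarith)]
    ring
  · filter_upwards [eventually_gt_atTop 0] with ν hν
    rw [one_mul, Real.rpow_neg hν.le, one_div]
    norm_cast
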